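/- arXiv:1612.09440 — 3 statements merged into one kernel-verified Lean document; each statement's English description precedes it below -/
import Mathlib

section
/- Let H be a real Hilbert space and Ψ : H → ℝ be twice Fréchet differentiable with ‖Ψ''(z)‖ ≤ h₂(‖z‖) for all z ∈ H, where h₂ is quasi-sublinear with constant C. Then for all x, u ∈ H: |Ψ(x+u) − Ψ(x) − Ψ'(x)(u)| ≤ C·h₂(‖x‖)·‖u‖² + C²·h₂(1)·h₂(‖u‖)·‖u‖². -/
/-- A continuous, non-decreasing function `h : [0,∞) → [0,∞)` is quasi-sublinear
with constant `C > 0` if `h(x+y) ≤ C(h(x)+h(y))` and `h(xy) ≤ C·h(x)·h(y)`. -/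
structure IsQuasiSublinear (h : ℝ → ℝ) (C : ℝ) : Prop where
  pos : 0 < C
  nonneg : ∀ x : ℝ, 0 ≤ x → 0 ≤ h x
  mono : MonotoneOn h (Set.Ici 0)
  cont : ContinuousOn h (Set.Ici 0)
  add_le : ∀ x y : ℝ, 0 ≤ x → 0 ≤ y → h (x + y) ≤ C * (h x + h y)
  mul_le : ∀ x y : ℝ, 0 ≤ x → 0 ≤ y → h (x * y) ≤ C * h x * h y

/-- Second-order Taylor estimate with a uniform bound on the second derivative along the segment
from `x` to `y`. -/
theorem norm_sub_sub_fderiv_le_of_norm_second_fderiv_le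
    {E F : Type*} [NormedAddCommGroup E] [NormedSpace ℝ E]
    [NormedAddCommGroup F] [NormedSpace ℝ F]
    {f : E → F} {f' : E → E →L[ℝ] F} {f'' : E → E →L[ℝ] E →L[ℝ] F} {x y : E} {K : ℝ}
    (hf' : ∀ z ∈ segment ℝ x y, HasFDerivAt f (f' z) z)
    (hf'' : ∀ z ∈ segment ℝ x y, HasFDerivAt f' (f'' z) z)
    (hK : ∀ z ∈ segment ℝ x y, ‖f'' z‖ ≤ K) :
    ‖f y - f x - f' x (y - x)‖ ≤ K * ‖y - x‖ ^ 2 := by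
  have hx : x ∈ segment ℝ x y := left_mem_segment ℝ x y
  have hy : y ∈ segment ℝ x y := right_mem_segment ℝ x y
  have hK0 : 0 ≤ K := (norm_nonneg (f'' x)).trans (hK x hx)
  have hlip : ∀ z ∈ segment ℝ x y, ‖f' z - f' x‖ ≤ K * ‖y - x‖ := fun z hz ↦
    ((convex_segment x y).norm_image_sub_le_of_norm_hasFDerivWithin_le
      (fun w hw ↦ (hf'' w hw).hasFDerivWithinAt) hK hx hz).trans
      (mul_le_mul_of_nonneg_left (norm_sub_le_of_mem_segment hz) hK0)
  calc ‖f y - f x - f' x (y - x)‖ ≤ K * ‖y - x‖ * ‖y - x‖ :=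
        (convex_segment x y).norm_image_sub_le_of_norm_hasFDerivWithin_le'
          (fun w hw ↦ (hf' w hw).hasFDerivWithinAt) hlip hx hy
    _ = K * ‖y - x‖ ^ 2 := by ring

/-- The value of a quasi-sublinear function at a sum, with the second term scaled by `h 1`. -/
theorem IsQuasiSublinear.add_le_add_one_mul {h : ℝ → ℝ} {C : ℝ} (hh : IsQuasiSublinear h C)
    {a b : ℝ} (ha : 0 ≤ a) (hb : 0 ≤ b) :
    h (a + b) ≤ C * h a + C ^ 2 * h 1 * h b := by
  have hmul : h b ≤ C * h 1 * h b := by simpa using hh.mul_le 1 b zero_le_one hb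
  calc h (a + b) ≤ C * (h a + h b) := hh.add_le a b ha hb
    _ ≤ C * (h a + C * h 1 * h b) := by
        gcongr
        exact hh.pos.le
    _ = C * h a + C ^ 2 * h 1 * h b := by ring

/-- Second-order Taylor estimate under a quasi-sublinear bound on the second
Fréchet derivative. -/
theorem taylor_second_order_quasiSublinear_bound
    {H : Type*} [NormedAddCommGroup H] [InnerProductSpace ℝ H] [CompleteSpace H]
    (Ψ : H → ℝ) (Ψ' : H → H →L[ℝ] ℝ) (Ψ'' : H → H →L[ℝ] H →L[ℝ] ℝ)
    (hΨ' : ∀ z : H, HasFDerivAt Ψ (Ψ' z) z)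
    (hΨ'' : ∀ z : H, HasFDerivAt Ψ' (Ψ'' z) z)
    (h₂ : ℝ → ℝ) (C : ℝ) (hqs : IsQuasiSublinear h₂ C)
    (hbound : ∀ z : H, ‖Ψ'' z‖ ≤ h₂ ‖z‖) (x u : H) :
    |Ψ (x + u) - Ψ x - Ψ' x u|
      ≤ C * h₂ ‖x‖ * ‖u‖ ^ 2 + C ^ 2 * h₂ 1 * h₂ ‖u‖ * ‖u‖ ^ 2 := by
  have hK : ∀ z ∈ segment ℝ x (x + u), ‖Ψ'' z‖ ≤ h₂ (‖x‖ + ‖u‖) := by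
    intro z hz
    have hzx : ‖z - x‖ ≤ ‖u‖ := by simpa using norm_sub_le_of_mem_segment hz
    have hz' : ‖z‖ ≤ ‖x‖ + ‖u‖ := (norm_le_norm_add_norm_sub' z x).trans (by gcongr)
    exact (hbound z).trans
      (hqs.mono (norm_nonneg z) (add_nonneg (norm_nonneg x) (norm_nonneg u)) hz')
  have htaylor := norm_sub_sub_fderiv_le_of_norm_second_fderiv_le
    (fun z _ ↦ hΨ' z) (fun z _ ↦ hΨ'' z) hK
  rw [add_sub_cancel_left, Real.norm_eq_abs] at htaylor
  calc |Ψ (x + u) - Ψ x - Ψ' x u| ≤ h₂ (‖x‖ + ‖u‖) * ‖u‖ ^ 2 := htaylor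
    _ ≤ (C * h₂ ‖x‖ + C ^ 2 * h₂ 1 * h₂ ‖u‖) * ‖u‖ ^ 2 := by
        gcongr
        exact hqs.add_le_add_one_mul (norm_nonneg x) (norm_nonneg u)
    _ = C * h₂ ‖x‖ * ‖u‖ ^ 2 + C ^ 2 * h₂ 1 * h₂ ‖u‖ * ‖u‖ ^ 2 := by ring
end

section
/- Let H be a real Hilbert space and Ψ : H → ℝ be Fréchet differentiable with ‖Ψ'(z)‖ ≤ h₁(‖z‖) for all z ∈ H, where h₁ is quasi-sublinear with constant C. Then for all x, u ∈ H: |Ψ(x+u) − Ψ(x)| ≤ C·h₁(‖x‖)·‖u‖ + C²·h₁(1)·h₁(‖u‖)·‖u‖. -/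
/-- Mean value estimate under a quasi-sublinear bound on the first Fréchet
derivative. -/
theorem increment_quasiSublinear_bound
    {H : Type*} [NormedAddCommGroup H] [InnerProductSpace ℝ H] [CompleteSpace H]
    (Ψ : H → ℝ) (Ψ' : H → H →L[ℝ] ℝ)
    (hΨ' : ∀ z : H, HasFDerivAt Ψ (Ψ' z) z)
    (h₁ : ℝ → ℝ) (C : ℝ) (hqs : IsQuasiSublinear h₁ C)
    (hbound : ∀ z : H, ‖Ψ' z‖ ≤ h₁ ‖z‖) (x u : H) :
    |Ψ (x + u) - Ψ x| ≤ C * h₁ ‖x‖ * ‖u‖ + C ^ 2 * h₁ 1 * h₁ ‖u‖ * ‖u‖ := by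
  have key : h₁ (‖x‖ + ‖u‖) ≤ C * h₁ ‖x‖ + C ^ 2 * h₁ 1 * h₁ ‖u‖ := by
    have hadd := hqs.add_le ‖x‖ ‖u‖ (norm_nonneg _) (norm_nonneg _)
    have hmul := hqs.mul_le 1 ‖u‖ zero_le_one (norm_nonneg _)
    rw [one_mul] at hmul
    nlinarith [mul_le_mul_of_nonneg_left hmul hqs.pos.le]
  have hderiv : ∀ z ∈ segment ℝ x (x + u), ‖Ψ' z‖ ≤ h₁ (‖x‖ + ‖u‖) := by
    intro z hz
    refine (hbound z).trans (hqs.mono (norm_nonneg z) (Set.mem_Ici.2 (by positivity)) ?_)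
    have hdist : ‖z - x‖ ≤ ‖u‖ := by simpa using norm_sub_le_of_mem_segment hz
    calc ‖z‖ = ‖x + (z - x)‖ := by rw [add_sub_cancel]
      _ ≤ ‖x‖ + ‖z - x‖ := norm_add_le _ _
      _ ≤ ‖x‖ + ‖u‖ := by gcongr
  have hmvt := (convex_segment x (x + u)).norm_image_sub_le_of_norm_hasFDerivWithin_le
    (fun z _ => (hΨ' z).hasFDerivWithinAt) hderiv
    (left_mem_segment ℝ x (x + u)) (right_mem_segment ℝ x (x + u))
  rw [Real.norm_eq_abs, add_sub_cancel_left] at hmvt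
  calc |Ψ (x + u) - Ψ x| ≤ h₁ (‖x‖ + ‖u‖) * ‖u‖ := hmvt
    _ ≤ (C * h₁ ‖x‖ + C ^ 2 * h₁ 1 * h₁ ‖u‖) * ‖u‖ := by gcongr
    _ = C * h₁ ‖x‖ * ‖u‖ + C ^ 2 * h₁ 1 * h₁ ‖u‖ * ‖u‖ := by ring
end

section
/- Let (V, 𝒜, β) be a σ-finite measure space, H a real Hilbert space, and Ψ : H → ℝ Fréchet differentiable with ‖Ψ'(z)‖ ≤ h₁(‖z‖) for all z ∈ H, where h₁ is quasi-sublinear with constant C. Let x ∈ H and let u : V → H be strongly measurable with ∫_V ‖u(v)‖² β(dv) < ∞ and ∫_V h₁(‖u(v)‖)²·‖u(v)‖² β(dv) < ∞. Then ∫_V |Ψ(x+u(v)) − Ψ(x)|² β(dv) ≤ 2C²·h₁(‖x‖)²·∫_V ‖u(v)‖² β(dv) + 2C⁴·h₁(1)²·∫_V h₁(‖u(v)‖)²·‖u(v)‖² β(dv) < ∞. -/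
open MeasureTheory

theorem IsQuasiSublinear.le_of_norm_le {H : Type*} [SeminormedAddCommGroup H]
    {h : ℝ → ℝ} {C : ℝ} (hh : IsQuasiSublinear h C) {x y z : H}
    (hz : ‖z - x‖ ≤ ‖y‖) :
    h ‖z‖ ≤ C * (h ‖x‖ + C * h 1 * h ‖y‖) := by
  have hzxy : ‖z‖ ≤ ‖x‖ + ‖y‖ := (norm_le_norm_add_norm_sub' z x).trans (by gcongr)
  have hy : h ‖y‖ ≤ C * h 1 * h ‖y‖ := by
    simpa using hh.mul_le 1 ‖y‖ zero_le_one (norm_nonneg y)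
  calc h ‖z‖ ≤ h (‖x‖ + ‖y‖) :=
        hh.mono (norm_nonneg z) (add_nonneg (norm_nonneg x) (norm_nonneg y)) hzxy
    _ ≤ C * (h ‖x‖ + h ‖y‖) := hh.add_le _ _ (norm_nonneg x) (norm_nonneg y)
    _ ≤ C * (h ‖x‖ + C * h 1 * h ‖y‖) :=
        mul_le_mul_of_nonneg_left (by gcongr) hh.pos.le

/-- Mean value estimate for a function whose derivative is bounded by a quasi-sublinear
function of the norm. -/
theorem IsQuasiSublinear.abs_sub_le {H : Type*} [NormedAddCommGroup H] [NormedSpace ℝ H]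
    {Ψ : H → ℝ} {Ψ' : H → H →L[ℝ] ℝ} (hΨ' : ∀ z, HasFDerivAt Ψ (Ψ' z) z)
    {h : ℝ → ℝ} {C : ℝ} (hh : IsQuasiSublinear h C) (hbound : ∀ z, ‖Ψ' z‖ ≤ h ‖z‖)
    (x y : H) :
    |Ψ (x + y) - Ψ x| ≤ C * (h ‖x‖ + C * h 1 * h ‖y‖) * ‖y‖ := by
  have key := (convex_closedBall x ‖y‖).norm_image_sub_le_of_norm_hasFDerivWithin_le
    (fun z _ => (hΨ' z).hasFDerivWithinAt)
    (fun z hz => (hbound z).trans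
      (hh.le_of_norm_le (mem_closedBall_iff_norm.mp hz)))
    (Metric.mem_closedBall_self (norm_nonneg y))
    (show x + y ∈ Metric.closedBall x ‖y‖ by simp)
  simpa using key

theorem IsQuasiSublinear.abs_sub_sq_le {H : Type*} [NormedAddCommGroup H] [NormedSpace ℝ H]
    {Ψ : H → ℝ} {Ψ' : H → H →L[ℝ] ℝ} (hΨ' : ∀ z, HasFDerivAt Ψ (Ψ' z) z)
    {h : ℝ → ℝ} {C : ℝ} (hh : IsQuasiSublinear h C) (hbound : ∀ z, ‖Ψ' z‖ ≤ h ‖z‖)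
    (x y : H) :
    |Ψ (x + y) - Ψ x| ^ 2 ≤ 2 * C ^ 2 * h ‖x‖ ^ 2 * ‖y‖ ^ 2
      + 2 * C ^ 4 * h 1 ^ 2 * (h ‖y‖ ^ 2 * ‖y‖ ^ 2) := by
  calc |Ψ (x + y) - Ψ x| ^ 2 ≤ (C * (h ‖x‖ + C * h 1 * h ‖y‖) * ‖y‖) ^ 2 :=
        pow_le_pow_left₀ (abs_nonneg _) (hh.abs_sub_le hΨ' hbound x y) 2
    _ = (C * ‖y‖) ^ 2 * (h ‖x‖ + C * h 1 * h ‖y‖) ^ 2 := by ring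
    _ ≤ (C * ‖y‖) ^ 2 * (2 * (h ‖x‖ ^ 2 + (C * h 1 * h ‖y‖) ^ 2)) :=
        mul_le_mul_of_nonneg_left add_sq_le (sq_nonneg _)
    _ = _ := by ring

/-- Square-integrability estimate for the jump increments under a quasi-sublinear
bound on the first Fréchet derivative. -/
theorem jump_increment_square_integrable_and_bounded
    {V : Type*} [MeasurableSpace V] (β : Measure V) [SigmaFinite β]
    {H : Type*} [NormedAddCommGroup H] [InnerProductSpace ℝ H] [CompleteSpace H]
    (Ψ : H → ℝ) (Ψ' : H → H →L[ℝ] ℝ)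
    (hΨ' : ∀ z : H, HasFDerivAt Ψ (Ψ' z) z)
    (h₁ : ℝ → ℝ) (C : ℝ) (hqs : IsQuasiSublinear h₁ C)
    (hbound : ∀ z : H, ‖Ψ' z‖ ≤ h₁ ‖z‖)
    (x : H) (u : V → H) (hu : StronglyMeasurable u)
    (hu2 : Integrable (fun v => ‖u v‖ ^ 2) β)
    (huh : Integrable (fun v => h₁ ‖u v‖ ^ 2 * ‖u v‖ ^ 2) β) :
    Integrable (fun v => |Ψ (x + u v) - Ψ x| ^ 2) β ∧
    ∫ v, |Ψ (x + u v) - Ψ x| ^ 2 ∂β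
      ≤ 2 * C ^ 2 * h₁ ‖x‖ ^ 2 * ∫ v, ‖u v‖ ^ 2 ∂β
        + 2 * C ^ 4 * h₁ 1 ^ 2 * ∫ v, h₁ ‖u v‖ ^ 2 * ‖u v‖ ^ 2 ∂β := by
  have hint := (hu2.const_mul (2 * C ^ 2 * h₁ ‖x‖ ^ 2)).add
    (huh.const_mul (2 * C ^ 4 * h₁ 1 ^ 2))
  have hle := fun v => hqs.abs_sub_sq_le hΨ' hbound x (u v)
  have hΨ : Continuous Ψ :=
    continuous_iff_continuousAt.mpr fun z => (hΨ' z).continuousAt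
  have hcont : Continuous fun y => |Ψ (x + y) - Ψ x| ^ 2 := by fun_prop
  have hincr : Integrable (fun v => |Ψ (x + u v) - Ψ x| ^ 2) β :=
    hint.mono' (hcont.comp_stronglyMeasurable hu).aestronglyMeasurable
      (.of_forall fun v => by simpa using hle v)
  refine ⟨hincr, (integral_mono hincr hint hle).trans_eq ?_⟩
  simp only [Pi.add_apply]
  rw [integral_add (hu2.const_mul _) (huh.const_mul _), integral_const_mul,
    integral_const_mul]
end
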